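/- arXiv:1204.0923 — 7 statements merged into one kernel-verified Lean document; each statement's English description precedes it below -/
import Mathlib

section
/- Let a < b be real numbers and let c ∈ (0,1] be a fixed real constant. Let f be twice differentiable on an open interval containing [a, a + c(b−a)] with f'' integrable on [a, a + c(b−a)]. If |f''| is φ-convex along the path from a to b, i.e. |f''(a + t c(b−a))| ≤ (1−t)|f''(a)| + t|f''(b)| for all t ∈ [0,1], then | (1/(c(b−a))) ∫_a^{a+c(b−a)} f(x) dx − (f(a) + f(a + c(b−a)))/2 | ≤ (c²(b−a)²/24) ( |f''(a)| + |f''(b)| ). -/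
/-- The trapezoidal rule error as an integral of the second derivative. -/
theorem integral_sub_mul_sub_mul_second_deriv {a d : ℝ} {f f' f'' : ℝ → ℝ}
    (hf' : ∀ x ∈ Set.uIcc a d, HasDerivAt f (f' x) x)
    (hf'' : ∀ x ∈ Set.uIcc a d, HasDerivAt f' (f'' x) x)
    (hint : IntervalIntegrable f'' MeasureTheory.volume a d) :
    ∫ x in a..d, (x - a) * (x - d) * f'' x
      = 2 * (∫ x in a..d, f x) - (d - a) * (f a + f d) := by
  have hi : IntervalIntegrable f MeasureTheory.volume a d :=
    (HasDerivAt.continuousOn hf').intervalIntegrable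
  have hi' : IntervalIntegrable (fun x => (x - a) * (x - d) * f'' x)
      MeasureTheory.volume a d :=
    hint.continuousOn_mul (by fun_prop)
  have key := intervalIntegral.integral_eq_sub_of_hasDerivAt
    (f := fun x => (x - a) * (x - d) * f' x - (2 * x - a - d) * f x)
    (f' := fun x => (x - a) * (x - d) * f'' x - 2 * f x) (a := a) (b := d)
    (fun x hx => by
      have h1 : HasDerivAt (fun x : ℝ => x - a) 1 x := (hasDerivAt_id x).sub_const a
      have h2 : HasDerivAt (fun x : ℝ => x - d) 1 x := (hasDerivAt_id x).sub_const d
      have h3 : HasDerivAt (fun x : ℝ => 2 * x - a - d) (2 * 1) x :=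
        (((hasDerivAt_id x).const_mul 2).sub_const a).sub_const d
      refine (((h1.mul h2).mul (hf'' x hx)).sub (h3.mul (hf' x hx))).congr_deriv ?_
      simp only [Pi.mul_apply]
      ring)
    (hi'.sub (hi.const_mul 2))
  rw [intervalIntegral.integral_sub hi' (hi.const_mul 2),
    intervalIntegral.integral_const_mul] at key
  linear_combination key

theorem integral_sub_mul_sub_mul_affine {a d : ℝ} (had : a ≠ d) (P Q : ℝ) :
    ∫ x in a..d, (x - a) * (d - x) * ((1 - (x - a) / (d - a)) * P + (x - a) / (d - a) * Q)
      = (d - a) ^ 3 / 12 * (P + Q) := by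
  have hL : d - a ≠ 0 := sub_ne_zero.mpr had.symm
  rw [intervalIntegral.integral_eq_sub_of_hasDerivAt
    (f := fun x => P * ((d - a) * (x - a) ^ 2 / 2 - (x - a) ^ 3 / 3)
      + (Q - P) * ((x - a) ^ 3 / 3 - (x - a) ^ 4 / (4 * (d - a))))]
  · field_simp
    ring
  · intro x _
    have h1 : HasDerivAt (fun x : ℝ => x - a) 1 x := (hasDerivAt_id x).sub_const a
    refine ((((((h1.fun_pow 2).const_mul (d - a)).div_const 2).sub
      ((h1.fun_pow 3).div_const 3)).const_mul P).add
      ((((h1.fun_pow 3).div_const 3).sub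
        ((h1.fun_pow 4).div_const (4 * (d - a)))).const_mul (Q - P))).congr_deriv ?_
    field_simp
    push_cast
    ring
  · exact Continuous.intervalIntegrable (by fun_prop) _ _

theorem stmt_1 (a b c : ℝ) (f f' f'' : ℝ → ℝ) (A B : ℝ)
    (hab : a < b) (hc0 : 0 < c) (hc1 : c ≤ 1)
    (hA : A < a) (hB : a + c * (b - a) < B)
    (hf' : ∀ x ∈ Set.Ioo A B, HasDerivAt f (f' x) x)
    (hf'' : ∀ x ∈ Set.Ioo A B, HasDerivAt f' (f'' x) x)
    (hint : IntervalIntegrable f'' MeasureTheory.volume a (a + c * (b - a)))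
    (hphi : ∀ t ∈ Set.Icc (0:ℝ) 1,
      |f'' (a + t * c * (b - a))| ≤ (1 - t) * |f'' a| + t * |f'' b|) :
    |(1 / (c * (b - a))) * (∫ x in a..(a + c * (b - a)), f x)
        - (f a + f (a + c * (b - a))) / 2|
      ≤ (c ^ 2 * (b - a) ^ 2 / 24) * (|f'' a| + |f'' b|) := by
  have hL : 0 < c * (b - a) := mul_pos hc0 (sub_pos.mpr hab)
  obtain ⟨d, hd⟩ : ∃ d, d = a + c * (b - a) := ⟨_, rfl⟩
  have hLd : c * (b - a) = d - a := by rw [hd]; ring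
  have hphi' : ∀ t ∈ Set.Icc (0:ℝ) 1,
      |f'' (a + t * (d - a))| ≤ (1 - t) * |f'' a| + t * |f'' b| := by
    intro t ht
    rw [← hLd, ← mul_assoc]
    exact hphi t ht
  rw [← mul_pow, ← hd, hLd]
  rw [← hd] at hB hint
  rw [hLd] at hL
  have had : a < d := sub_pos.mp hL
  have hsub : ∀ x ∈ Set.uIcc a d, x ∈ Set.Ioo A B := by
    intro x hx
    rw [Set.uIcc_of_le had.le] at hx
    exact ⟨hA.trans_le hx.1, hx.2.trans_lt hB⟩
  have herr := integral_sub_mul_sub_mul_second_deriv (fun x hx => hf' x (hsub x hx))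
    (fun x hx => hf'' x (hsub x hx)) hint
  have hbound : ‖∫ x in a..d, (x - a) * (x - d) * f'' x‖
      ≤ (d - a) ^ 3 / 12 * (|f'' a| + |f'' b|) := by
    rw [← integral_sub_mul_sub_mul_affine had.ne]
    refine intervalIntegral.norm_integral_le_of_norm_le had.le
      (Filter.Eventually.of_forall fun x hx => ?_)
      (Continuous.intervalIntegrable (by fun_prop) _ _)
    have hxa : 0 ≤ x - a := sub_nonneg.mpr hx.1.le
    have hxd : 0 ≤ d - x := sub_nonneg.mpr hx.2
    have ht := hphi' ((x - a) / (d - a))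
      ⟨div_nonneg hxa hL.le, (div_le_one hL).mpr (by linarith)⟩
    rw [div_mul_cancel₀ _ hL.ne', add_sub_cancel] at ht
    rw [Real.norm_eq_abs, abs_mul, abs_mul, abs_of_nonneg hxa, abs_sub_comm x d,
      abs_of_nonneg hxd]
    exact mul_le_mul_of_nonneg_left ht (mul_nonneg hxa hxd)
  have hrepr : 1 / (d - a) * (∫ x in a..d, f x) - (f a + f d) / 2
      = 1 / (2 * (d - a)) * ∫ x in a..d, (x - a) * (x - d) * f'' x := by
    rw [herr]
    field_simp
  rw [hrepr, abs_mul, abs_of_pos (by positivity)]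
  calc 1 / (2 * (d - a)) * |∫ x in a..d, (x - a) * (x - d) * f'' x|
      ≤ 1 / (2 * (d - a)) * ((d - a) ^ 3 / 12 * (|f'' a| + |f'' b|)) :=
        mul_le_mul_of_nonneg_left hbound (by positivity)
    _ = (d - a) ^ 2 / 24 * (|f'' a| + |f'' b|) := by
        field_simp
        ring
end

section
/- Let a < b be real numbers, let c ∈ (0,1] be a fixed real constant, and let p > 1 with q = p/(p−1). Let f be twice differentiable on an open interval containing [a, a + c(b−a)] with f'' integrable on [a, a + c(b−a)]. If |f''|^q is φ-convex along the path from a to b, i.e. |f''(a + t c(b−a))|^q ≤ (1−t)|f''(a)|^q + t|f''(b)|^q for all t ∈ [0,1], then | (1/(c(b−a))) ∫_a^{a+c(b−a)} f(x) dx − (f(a) + f(a + c(b−a)))/2 | ≤ (c²(b−a)²/8) (√π/2)^{1/p} ( Γ(p+1)/Γ(3/2 + p) )^{1/p} ( ( |f''(a)|^q + |f''(b)|^q )/2 )^{1/q}. -/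
open MeasureTheory Set intervalIntegral

/-- The error of the trapezoid rule on `[0, 1]` as an integral of the second derivative. -/
theorem integral_mul_one_sub_mul_second_deriv {f f' f'' : ℝ → ℝ}
    (hf' : ∀ x ∈ uIcc (0 : ℝ) 1, HasDerivAt f (f' x) x)
    (hf'' : ∀ x ∈ uIcc (0 : ℝ) 1, HasDerivAt f' (f'' x) x)
    (hint : IntervalIntegrable f'' volume 0 1) :
    ∫ t in (0 : ℝ)..1, t * (1 - t) * f'' t = f 0 + f 1 - 2 * ∫ t in (0 : ℝ)..1, f t := by
  have hu : ∀ x ∈ uIcc (0 : ℝ) 1, HasDerivAt (fun t : ℝ => t * (1 - t)) (1 - 2 * x) x := by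
    intro x _
    have h := (hasDerivAt_id x).mul ((hasDerivAt_id x).const_sub 1)
    refine h.congr_deriv ?_
    simp only [id]
    ring
  have hu' : ∀ x ∈ uIcc (0 : ℝ) 1, HasDerivAt (fun t : ℝ => 1 - 2 * t) (-2) x := by
    intro x _
    have h := ((hasDerivAt_id x).const_mul 2).const_sub 1
    exact h.congr_deriv (by ring)
  have hcont : ContinuousOn f' (uIcc 0 1) := fun x hx =>
    (hf'' x hx).continuousAt.continuousWithinAt
  rw [integral_mul_deriv_eq_deriv_mul hu hf''
      ((by fun_prop : Continuous fun t : ℝ => 1 - 2 * t).intervalIntegrable _ _) hint,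
    integral_mul_deriv_eq_deriv_mul hu' hf' intervalIntegrable_const hcont.intervalIntegrable,
    intervalIntegral.integral_const_mul]
  ring

theorem integral_mul_one_sub_rpow {p : ℝ} (hp : 0 < p) :
    ∫ t in (0 : ℝ)..1, (t * (1 - t)) ^ p
      = (1 / 4) ^ p * (√Real.pi / 2 * (Real.Gamma (p + 1) / Real.Gamma (3 / 2 + p))) := by
  have hbeta : ∫ t in (0 : ℝ)..1, (t * (1 - t)) ^ p = ProbabilityTheory.beta (p + 1) (p + 1) := by
    rw [ProbabilityTheory.beta_eq_betaIntegralReal _ _ (by linarith) (by linarith),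
      Complex.betaIntegral, ← Complex.ofReal_re (∫ t in (0 : ℝ)..1, (t * (1 - t)) ^ p),
      ← intervalIntegral.integral_ofReal]
    congr 1
    refine integral_congr fun t ht => ?_
    rw [uIcc_of_le zero_le_one] at ht
    have h1 : (0 : ℝ) ≤ 1 - t := sub_nonneg.2 ht.2
    simp only [Complex.ofReal_add, Complex.ofReal_one, add_sub_cancel_right]
    rw [Real.mul_rpow ht.1 h1, Complex.ofReal_mul, Complex.ofReal_cpow ht.1,
      Complex.ofReal_cpow h1, Complex.ofReal_sub, Complex.ofReal_one]
  have hdup := Real.Gamma_mul_Gamma_add_half (p + 1)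
  have hpow : (2 : ℝ) ^ (1 - 2 * (p + 1)) = (1 / 4) ^ p / 2 := by
    rw [show 1 - 2 * (p + 1) = -2 * p - 1 by ring, Real.rpow_sub two_pos, Real.rpow_one,
      Real.rpow_mul two_pos.le]
    norm_num [Real.rpow_neg]
  rw [hpow, show p + 1 + 1 / 2 = 3 / 2 + p by ring,
    show 2 * (p + 1) = p + 1 + (p + 1) by ring] at hdup
  have h1 : Real.Gamma (p + 1 + (p + 1)) ≠ 0 := (Real.Gamma_pos_of_pos (by linarith)).ne'
  have h2 : Real.Gamma (3 / 2 + p) ≠ 0 := (Real.Gamma_pos_of_pos (by linarith)).ne'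
  rw [hbeta, ProbabilityTheory.beta]
  field_simp at hdup ⊢
  linear_combination hdup

/-- Hölder's inequality for `t (1 - t)` against a function whose `q`-th power lies below a chord. -/
theorem abs_integral_mul_one_sub_mul_le {p q P Q : ℝ} {g : ℝ → ℝ} (hpq : p.HolderConjugate q)
    (hP : 0 ≤ P) (hQ : 0 ≤ Q) (hg : IntervalIntegrable g volume 0 1)
    (hle : ∀ t ∈ Icc (0 : ℝ) 1, |g t| ^ q ≤ (1 - t) * P + t * Q) :
    |∫ t in (0 : ℝ)..1, t * (1 - t) * g t|
      ≤ (∫ t in (0 : ℝ)..1, (t * (1 - t)) ^ p) ^ (1 / p) * ((P + Q) / 2) ^ (1 / q) := by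
  have hq0 : 0 < q := hpq.symm.pos
  have hmem : ∀ᵐ t ∂volume.restrict (Ioc (0 : ℝ) 1), t ∈ Ioc (0 : ℝ) 1 :=
    ae_restrict_mem measurableSet_Ioc
  have hw : ∀ t ∈ Ioc (0 : ℝ) 1, 0 ≤ t * (1 - t) := fun t ht =>
    mul_nonneg ht.1.le (sub_nonneg.2 ht.2)
  have hgm : AEStronglyMeasurable g (volume.restrict (Ioc (0 : ℝ) 1)) :=
    hg.1.aestronglyMeasurable
  have hgbound : ∀ t ∈ Ioc (0 : ℝ) 1, |g t| ≤ (P + Q) ^ q⁻¹ := fun t ht => by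
    refine (Real.le_rpow_inv_iff_of_pos (abs_nonneg _) (by positivity) hq0).2
      ((hle t (Ioc_subset_Icc_self ht)).trans ?_)
    nlinarith [ht.1, ht.2, mul_nonneg ht.1.le hP, mul_nonneg (sub_nonneg.2 ht.2) hQ]
  have hgL : MemLp (fun t => |g t|) (ENNReal.ofReal q) (volume.restrict (Ioc (0 : ℝ) 1)) := by
    refine MemLp.of_bound hgm.norm ((P + Q) ^ q⁻¹) ?_
    filter_upwards [hmem] with t ht
    simpa using hgbound t ht
  have hwL : MemLp (fun t : ℝ => t * (1 - t)) (ENNReal.ofReal p)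
      (volume.restrict (Ioc (0 : ℝ) 1)) := by
    refine MemLp.of_bound (by fun_prop) 1 ?_
    filter_upwards [hmem] with t ht
    rw [Real.norm_of_nonneg (hw t ht)]
    nlinarith [ht.1, ht.2]
  have hqint : IntervalIntegrable (fun t => |g t| ^ q) volume 0 1 := by
    rw [intervalIntegrable_iff_integrableOn_Ioc_of_le zero_le_one]
    have h := hgL.integrable_norm_rpow (by simpa using hq0) ENNReal.ofReal_ne_top
    simpa [IntegrableOn, ENNReal.toReal_ofReal hq0.le] using h
  have hchord : ∫ t in (0 : ℝ)..1, |g t| ^ q ≤ (P + Q) / 2 := by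
    have hc : ∫ t in (0 : ℝ)..1, ((1 - t) * P + t * Q) = (P + Q) / 2 := by
      rw [intervalIntegral.integral_add
          (Continuous.intervalIntegrable (by fun_prop) _ _)
          (Continuous.intervalIntegrable (by fun_prop) _ _),
        intervalIntegral.integral_mul_const, intervalIntegral.integral_mul_const,
        intervalIntegral.integral_sub intervalIntegrable_const
          intervalIntegrable_id]
      simp only [integral_id, intervalIntegral.integral_const, smul_eq_mul]
      ring
    rw [← hc]
    exact integral_mono_on zero_le_one hqint
      (Continuous.intervalIntegrable (by fun_prop) _ _) hle
  calc |∫ t in (0 : ℝ)..1, t * (1 - t) * g t|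
      ≤ ∫ t in (0 : ℝ)..1, |t * (1 - t) * g t| :=
        abs_integral_le_integral_abs zero_le_one
    _ = ∫ t in Ioc (0 : ℝ) 1, t * (1 - t) * |g t| := by
        rw [integral_of_le zero_le_one]
        refine setIntegral_congr_fun measurableSet_Ioc fun t ht => ?_
        simp only [abs_mul (t * (1 - t)), abs_of_nonneg (hw t ht)]
    _ ≤ (∫ t in Ioc (0 : ℝ) 1, (t * (1 - t)) ^ p) ^ (1 / p)
          * (∫ t in Ioc (0 : ℝ) 1, |g t| ^ q) ^ (1 / q) := by
        refine integral_mul_le_Lp_mul_Lq_of_nonneg hpq ?_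
          (Filter.Eventually.of_forall fun t => abs_nonneg _) hwL hgL
        filter_upwards [hmem] with t ht using hw t ht
    _ ≤ _ := by
        rw [← integral_of_le zero_le_one, ← integral_of_le zero_le_one]
        have h0 : 0 ≤ ∫ t in (0 : ℝ)..1, |g t| ^ q :=
          integral_nonneg zero_le_one fun t _ => by positivity
        have h1 : 0 ≤ ∫ t in (0 : ℝ)..1, (t * (1 - t)) ^ p :=
          integral_nonneg zero_le_one fun t ht =>
            Real.rpow_nonneg (mul_nonneg ht.1 (sub_nonneg.2 ht.2)) _
        gcongr


theorem stmt_2 (a b c p q : ℝ) (f f' f'' : ℝ → ℝ) (A B : ℝ)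
    (hab : a < b) (hc0 : 0 < c) (hc1 : c ≤ 1)
    (hp : 1 < p) (hq : q = p / (p - 1))
    (hA : A < a) (hB : a + c * (b - a) < B)
    (hf' : ∀ x ∈ Set.Ioo A B, HasDerivAt f (f' x) x)
    (hf'' : ∀ x ∈ Set.Ioo A B, HasDerivAt f' (f'' x) x)
    (hint : IntervalIntegrable f'' MeasureTheory.volume a (a + c * (b - a)))
    (hphi : ∀ t ∈ Set.Icc (0:ℝ) 1,
      |f'' (a + t * c * (b - a))| ^ q ≤ (1 - t) * |f'' a| ^ q + t * |f'' b| ^ q) :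
    |(1 / (c * (b - a))) * (∫ x in a..(a + c * (b - a)), f x)
        - (f a + f (a + c * (b - a))) / 2|
      ≤ (c ^ 2 * (b - a) ^ 2 / 8) * (Real.sqrt Real.pi / 2) ^ (1 / p)
          * (Real.Gamma (p + 1) / Real.Gamma (3 / 2 + p)) ^ (1 / p)
          * ((|f'' a| ^ q + |f'' b| ^ q) / 2) ^ (1 / q) := by
  have hpq : p.HolderConjugate q := Real.holderConjugate_iff_eq_conjExponent hp |>.2 hq
  have hp0 : 0 < p := by linarith
  obtain ⟨h, hh⟩ : ∃ h, h = c * (b - a) := ⟨_, rfl⟩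
  have hpos : 0 < h := hh ▸ mul_pos hc0 (sub_pos.2 hab)
  rw [← hh] at hB hint ⊢
  have hmem : ∀ t ∈ uIcc (0 : ℝ) 1, a + h * t ∈ Ioo A B := by
    intro t ht
    rw [uIcc_of_le zero_le_one] at ht
    constructor <;> nlinarith [ht.1, ht.2]
  have haff : ∀ t : ℝ, HasDerivAt (fun t => a + h * t) h t := fun t => by
    simpa using ((hasDerivAt_id t).const_mul h).const_add a
  have hg' : ∀ t ∈ uIcc (0 : ℝ) 1, HasDerivAt (fun t => f (a + h * t)) (h * f' (a + h * t)) t :=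
    fun t ht => by
      simpa [mul_comm, Function.comp_def] using (hf' _ (hmem t ht)).comp t (haff t)
  have hg'' : ∀ t ∈ uIcc (0 : ℝ) 1,
      HasDerivAt (fun t => h * f' (a + h * t)) (h * (h * f'' (a + h * t))) t :=
    fun t ht => by
      simpa [mul_comm, Function.comp_def] using
        ((hf'' _ (hmem t ht)).comp t (haff t)).const_mul h
  have hgint : IntervalIntegrable (fun t => f'' (a + h * t)) volume 0 1 := by
    simpa [hpos.ne'] using (hint.comp_add_left a).comp_mul_left (c := h)
  have hid := integral_mul_one_sub_mul_second_deriv hg' hg'' ((hgint.const_mul h).const_mul h)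
  have hpull : ∫ t in (0 : ℝ)..1, t * (1 - t) * (h * (h * f'' (a + h * t)))
      = h ^ 2 * ∫ t in (0 : ℝ)..1, t * (1 - t) * f'' (a + h * t) := by
    rw [← intervalIntegral.integral_const_mul]
    congr 1 with t
    ring
  rw [hpull, integral_comp_add_mul f hpos.ne' a] at hid
  simp only [mul_zero, add_zero, mul_one, smul_eq_mul] at hid
  have hbound := abs_integral_mul_one_sub_mul_le hpq (P := |f'' a| ^ q) (Q := |f'' b| ^ q)
    (by positivity) (by positivity) hgint fun t ht => by
      have := hphi t ht
      rwa [show a + t * c * (b - a) = a + h * t by rw [hh]; ring] at this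
  have hG : 0 ≤ Real.Gamma (p + 1) / Real.Gamma (3 / 2 + p) :=
    div_nonneg (Real.Gamma_pos_of_pos (by linarith)).le (Real.Gamma_pos_of_pos (by linarith)).le
  rw [integral_mul_one_sub_rpow hp0, Real.mul_rpow (by positivity) (by positivity),
    Real.mul_rpow (by positivity) hG, ← Real.rpow_mul (by norm_num),
    mul_one_div_cancel hp0.ne', Real.rpow_one] at hbound
  have herr : 1 / h * (∫ x in a..(a + h), f x) - (f a + f (a + h)) / 2
      = -(h ^ 2 / 2 * ∫ t in (0 : ℝ)..1, t * (1 - t) * f'' (a + h * t)) := by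
    rw [one_div]
    linear_combination (1 / 2) * hid
  rw [herr, abs_neg, abs_mul, abs_of_nonneg (by positivity), ← mul_pow, ← hh]
  refine (mul_le_mul_of_nonneg_left hbound (by positivity)).trans_eq ?_
  ring
end

section
/- Let a < b be real numbers and let c ∈ (0,1] be a fixed real constant. Let f be twice differentiable on an open interval containing [a, a + c(b−a)] with f'' integrable on [a, a + c(b−a)]. Assume |f''(a)| > 0, |f''(b)| > 0, |f''(a)| ≠ |f''(b)|, and that |f''| is log-φ-convex along the path from a to b, i.e. |f''(a + t c(b−a))| ≤ |f''(a)|^{1−t} |f''(b)|^{t} for all t ∈ [0,1]. Then | (1/(c(b−a))) ∫_a^{a+c(b−a)} f(x) dx − (f(a) + f(a + c(b−a)))/2 | ≤ ( c(b−a) / ( log|f''(b)| − log|f''(a)| ) )² [ A(|f''(b)|, |f''(a)|) − L(|f''(b)|, |f''(a)|) ], where A(x,y) = (x+y)/2 is the arithmetic mean and L(x,y) = (x−y)/(log x − log y) is the logarithmic mean. -/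
/-- Trapezoid rule with the second-order Peano kernel `(x - a) * (e - x)`. -/
theorem integral_peano_kernel_mul_deriv2 {a e : ℝ} {f f' f'' : ℝ → ℝ}
    (hf : ∀ x ∈ Set.uIcc a e, HasDerivAt f (f' x) x)
    (hf' : ∀ x ∈ Set.uIcc a e, HasDerivAt f' (f'' x) x)
    (hint : IntervalIntegrable f'' MeasureTheory.volume a e) :
    (∫ x in a..e, (x - a) * (e - x) * f'' x)
      = (e - a) * (f a + f e) - 2 * ∫ x in a..e, f x := by
  have hf_int : IntervalIntegrable f MeasureTheory.volume a e :=
    ContinuousOn.intervalIntegrable fun x hx => (hf x hx).continuousAt.continuousWithinAt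
  have hw_int : IntervalIntegrable (fun x => (x - a) * (e - x) * f'' x)
      MeasureTheory.volume a e :=
    hint.continuousOn_mul (by fun_prop)
  have hderiv : ∀ x ∈ Set.uIcc a e,
      HasDerivAt (fun y => (y - a) * (e - y) * f' y - (a + e - 2 * y) * f y)
        ((x - a) * (e - x) * f'' x + 2 * f x) x := by
    intro x hx
    have h1 := (((hasDerivAt_id x).sub_const a).mul ((hasDerivAt_id x).const_sub e)).mul (hf' x hx)
    have h2 := (((hasDerivAt_id x).const_mul 2).const_sub (a + e)).mul (hf x hx)
    refine (h1.sub h2).congr_deriv ?_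
    simp
    ring
  have key := intervalIntegral.integral_eq_sub_of_hasDerivAt hderiv
    (hw_int.add (hf_int.const_mul 2))
  rw [intervalIntegral.integral_add hw_int (hf_int.const_mul 2),
    intervalIntegral.integral_const_mul] at key
  linear_combination key

theorem integral_peano_kernel_mul_exp (a e P : ℝ) {r : ℝ} (hr : r ≠ 0) :
    (∫ x in a..e, (x - a) * (e - x) * (P * Real.exp (r * (x - a))))
      = (e - a) * (P + P * Real.exp (r * (e - a))) / r ^ 2
        - 2 * (P * Real.exp (r * (e - a)) - P) / r ^ 3 := by
  have hderiv : ∀ x ∈ Set.uIcc a e,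
      HasDerivAt (fun y => P * Real.exp (r * (y - a)) *
          ((y - a) * (e - y) / r - (a + e - 2 * y) / r ^ 2 - 2 / r ^ 3))
        ((x - a) * (e - x) * (P * Real.exp (r * (x - a)))) x := by
    intro x _
    have hg := ((((hasDerivAt_id x).sub_const a).const_mul r).exp).const_mul P
    have h1 := (((hasDerivAt_id x).sub_const a).mul ((hasDerivAt_id x).const_sub e)).div_const r
    have h2 := (((hasDerivAt_id x).const_mul 2).const_sub (a + e)).div_const (r ^ 2)
    refine (hg.mul ((h1.sub h2).sub_const (2 / r ^ 3))).congr_deriv ?_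
    simp
    field_simp
    ring
  rw [intervalIntegral.integral_eq_sub_of_hasDerivAt hderiv
    (Continuous.intervalIntegrable (by fun_prop) _ _)]
  simp
  field_simp
  ring

theorem rpow_one_sub_mul_rpow_eq_mul_exp {P Q : ℝ} (hP : 0 < P) (hQ : 0 < Q) (t : ℝ) :
    P ^ (1 - t) * Q ^ t = P * Real.exp ((Real.log Q - Real.log P) * t) := by
  rw [Real.rpow_def_of_pos hP, Real.rpow_def_of_pos hQ, ← Real.exp_add]
  nth_rewrite 2 [← Real.exp_log hP]
  rw [← Real.exp_add]
  ring_nf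


theorem stmt_3 (a b c : ℝ) (f f' f'' : ℝ → ℝ) (A B : ℝ)
    (hab : a < b) (hc0 : 0 < c) (hc1 : c ≤ 1)
    (hA : A < a) (hB : a + c * (b - a) < B)
    (hf' : ∀ x ∈ Set.Ioo A B, HasDerivAt f (f' x) x)
    (hf'' : ∀ x ∈ Set.Ioo A B, HasDerivAt f' (f'' x) x)
    (hint : IntervalIntegrable f'' MeasureTheory.volume a (a + c * (b - a)))
    (ha0 : 0 < |f'' a|) (hb0 : 0 < |f'' b|) (hne : |f'' a| ≠ |f'' b|)
    (hphi : ∀ t ∈ Set.Icc (0:ℝ) 1,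
      |f'' (a + t * c * (b - a))| ≤ |f'' a| ^ (1 - t) * |f'' b| ^ t) :
    |(1 / (c * (b - a))) * (∫ x in a..(a + c * (b - a)), f x)
        - (f a + f (a + c * (b - a))) / 2|
      ≤ (c * (b - a) / (Real.log |f'' b| - Real.log |f'' a|)) ^ 2
          * ((|f'' b| + |f'' a|) / 2
              - (|f'' b| - |f'' a|) / (Real.log |f'' b| - Real.log |f'' a|)) := by
  set P := |f'' a|
  set Q := |f'' b|
  set k := Real.log Q - Real.log P with hk
  obtain ⟨h, hh⟩ : ∃ h, h = c * (b - a) := ⟨_, rfl⟩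
  have hpos : 0 < h := hh ▸ mul_pos hc0 (sub_pos.mpr hab)
  rw [← hh] at hB hint ⊢
  have hk0 : k ≠ 0 := fun h0 =>
    hne (Real.log_injOn_pos ha0 hb0 (sub_eq_zero.mp h0).symm)
  have hle : a ≤ a + h := by linarith
  have hsub : Set.uIcc a (a + h) ⊆ Set.Ioo A B := by
    rw [Set.uIcc_of_le hle]
    exact fun x hx => ⟨by linarith [hx.1], by linarith [hx.2]⟩
  have htrap := integral_peano_kernel_mul_deriv2 (fun x hx => hf' x (hsub hx))
    (fun x hx => hf'' x (hsub hx)) hint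
  have hbound : |∫ x in a..(a + h), (x - a) * (a + h - x) * f'' x| ≤
      ∫ x in a..(a + h), (x - a) * (a + h - x) * (P * Real.exp (k / h * (x - a))) := by
    rw [← Real.norm_eq_abs]
    refine intervalIntegral.norm_integral_le_of_norm_le hle
      (Filter.Eventually.of_forall fun x hx => ?_)
      (Continuous.intervalIntegrable (by fun_prop) _ _)
    have h1 : 0 ≤ x - a := by linarith [hx.1]
    have h2 : 0 ≤ a + h - x := by linarith [hx.2]
    rw [Real.norm_eq_abs, abs_mul, abs_of_nonneg (mul_nonneg h1 h2)]
    refine mul_le_mul_of_nonneg_left ?_ (mul_nonneg h1 h2)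
    have hx' := hphi ((x - a) / h)
      ⟨div_nonneg h1 hpos.le, (div_le_one hpos).mpr (by linarith)⟩
    rw [rpow_one_sub_mul_rpow_eq_mul_exp ha0 hb0, mul_assoc, ← hh,
      div_mul_cancel₀ _ hpos.ne', add_sub_cancel, ← hk, mul_div_left_comm,
      mul_comm (x - a)] at hx'
    exact hx'
  rw [integral_peano_kernel_mul_exp _ _ _ (div_ne_zero hk0 hpos.ne'), add_sub_cancel_left,
    div_mul_cancel₀ _ hpos.ne', hk, Real.exp_sub, Real.exp_log ha0, Real.exp_log hb0,
    mul_div_cancel₀ _ ha0.ne', ← hk] at hbound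
  have hlhs : 1 / h * (∫ x in a..(a + h), f x) - (f a + f (a + h)) / 2
      = -(∫ x in a..(a + h), (x - a) * (a + h - x) * f'' x) / (2 * h) := by
    rw [htrap]
    field_simp
    ring
  rw [hlhs, abs_div, abs_neg, abs_of_pos (by positivity : (0 : ℝ) < 2 * h),
    div_le_iff₀ (by positivity)]
  refine hbound.trans_eq ?_
  field_simp
  ring
end

section
/- Let a < b be real numbers, let c ∈ (0,1] be a fixed real constant, and let p > 1 with q = p/(p−1). Let f be twice differentiable on an open interval containing [a, a + c(b−a)] with f'' integrable on [a, a + c(b−a)]. If |f''|^q is quasi-φ-convex along the path from a to b, i.e. |f''(a + t c(b−a))|^q ≤ max{ |f''(a)|^q, |f''(b)|^q } for all t ∈ [0,1], then | (1/(c(b−a))) ∫_a^{a+c(b−a)} f(x) dx − (f(a) + f(a + c(b−a)))/2 | ≤ (c²(b−a)²/8) (√π/2)^{1/p} ( Γ(p+1)/Γ(3/2 + p) )^{1/p} ( max{ |f''(a)|^q, |f''(b)|^q } )^{1/q}. -/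
open MeasureTheory intervalIntegral in
/-- The trapezoidal error as an integral of the second derivative against the Peano kernel. -/
lemma integral_peano_kernel_mul {f f' f'' : ℝ → ℝ} {a e : ℝ}
    (hf' : ∀ x ∈ Set.uIcc a e, HasDerivAt f (f' x) x)
    (hf'' : ∀ x ∈ Set.uIcc a e, HasDerivAt f' (f'' x) x)
    (hint : IntervalIntegrable f'' volume a e) :
    ∫ x in a..e, (x - a) * (e - x) * f'' x
      = (e - a) * (f a + f e) - 2 * ∫ x in a..e, f x := by
  have hf'i : IntervalIntegrable f' volume a e :=
    ContinuousOn.intervalIntegrable fun x hx ↦ (hf'' x hx).continuousAt.continuousWithinAt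
  have hk (x : ℝ) : HasDerivAt (fun x ↦ (x - a) * (e - x)) (a + e - 2 * x) x := by
    convert! ((hasDerivAt_id x).sub_const a).mul ((hasDerivAt_id x).const_sub e) using 1
    simp only [id]
    ring
  have hk' (x : ℝ) : HasDerivAt (fun x ↦ a + e - 2 * x) (-2) x := by
    convert! ((hasDerivAt_id x).const_mul 2).const_sub (a + e) using 1
    ring
  rw [integral_mul_deriv_eq_deriv_mul (fun x _ ↦ hk x) hf''
      (Continuous.intervalIntegrable (by fun_prop) _ _) hint,
    integral_mul_deriv_eq_deriv_mul (fun x _ ↦ hk' x) hf'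
      (Continuous.intervalIntegrable (by fun_prop) _ _) hf'i, intervalIntegral.integral_const_mul]
  ring

lemma integral_peano_kernel (a e : ℝ) :
    ∫ x in a..e, (x - a) * (e - x) = (e - a) ^ 3 / 6 := by
  have h (x : ℝ) : HasDerivAt (fun x ↦ (e - a) * (x - a) ^ 2 / 2 - (x - a) ^ 3 / 3)
      ((x - a) * (e - x)) x := by
    have h1 := (hasDerivAt_id x).sub_const a
    convert! (((h1.pow 2).const_mul (e - a)).div_const 2).sub ((h1.pow 3).div_const 3) using 1
    simp only [id]
    ring
  rw [intervalIntegral.integral_eq_sub_of_hasDerivAt (fun x _ ↦ h x)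
    (Continuous.intervalIntegrable (by fun_prop) _ _)]
  ring

open MeasureTheory in
/-- The trapezoidal error bound for a second derivative bounded by `M`. -/
lemma abs_average_sub_trapezoid_le {f f' f'' : ℝ → ℝ} {a e M : ℝ} (hae : a < e)
    (hf' : ∀ x ∈ Set.Icc a e, HasDerivAt f (f' x) x)
    (hf'' : ∀ x ∈ Set.Icc a e, HasDerivAt f' (f'' x) x)
    (hint : IntervalIntegrable f'' volume a e) (hM : ∀ x ∈ Set.Icc a e, |f'' x| ≤ M) :
    |1 / (e - a) * (∫ x in a..e, f x) - (f a + f e) / 2| ≤ (e - a) ^ 2 / 12 * M := by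
  have hpos : 0 < e - a := sub_pos.2 hae
  have hbound : |∫ x in a..e, (x - a) * (e - x) * f'' x| ≤ (e - a) ^ 3 / 6 * M := by
    rw [← integral_peano_kernel, ← intervalIntegral.integral_mul_const, ← Real.norm_eq_abs]
    refine intervalIntegral.norm_integral_le_of_norm_le hae.le (ae_of_all _ fun x hx ↦ ?_)
      (Continuous.intervalIntegrable (by fun_prop) _ _)
    have h0 : 0 ≤ (x - a) * (e - x) :=
      mul_nonneg (sub_nonneg.2 hx.1.le) (sub_nonneg.2 hx.2)
    rw [Real.norm_eq_abs, abs_mul, abs_of_nonneg h0]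
    exact mul_le_mul_of_nonneg_left (hM x ⟨hx.1.le, hx.2⟩) h0
  rw [← Set.uIcc_of_le hae.le] at hf' hf''
  have hrepr : 1 / (e - a) * (∫ x in a..e, f x) - (f a + f e) / 2
      = -(1 / (2 * (e - a)) * ∫ x in a..e, (x - a) * (e - x) * f'' x) := by
    rw [integral_peano_kernel_mul hf' hf'' hint]
    field_simp
    ring
  rw [hrepr, abs_neg, abs_mul, abs_of_pos (by positivity)]
  calc _ ≤ 1 / (2 * (e - a)) * ((e - a) ^ 3 / 6 * M) := by gcongr
    _ = _ := by field_simp; ring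

lemma integral_rpow_mul_one_sub_rpow {p : ℝ} (hp : 0 ≤ p) :
    ∫ x in (0 : ℝ)..1, (x * (1 - x)) ^ p
      = Real.Gamma (p + 1) * Real.Gamma (p + 1) / Real.Gamma (2 * (p + 1)) := by
  have h := ProbabilityTheory.beta_eq_betaIntegralReal (p + 1) (p + 1) (by linarith) (by linarith)
  rw [ProbabilityTheory.beta, ← two_mul] at h
  rw [h]
  suffices Complex.betaIntegral ↑(p + 1) ↑(p + 1)
      = ((∫ x in (0 : ℝ)..1, (x * (1 - x)) ^ p : ℝ) : ℂ) by rw [this, Complex.ofReal_re]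
  rw [Complex.betaIntegral, ← intervalIntegral.integral_ofReal]
  refine intervalIntegral.integral_congr fun x hx ↦ ?_
  rw [Set.uIcc_of_le zero_le_one] at hx
  have h1 : 0 ≤ 1 - x := sub_nonneg.2 hx.2
  simp only [Complex.ofReal_add, Complex.ofReal_one, add_sub_cancel_right]
  rw [Real.mul_rpow hx.1 h1, Complex.ofReal_mul, Complex.ofReal_cpow hx.1, Complex.ofReal_cpow h1]
  simp

/-- Jensen's inequality for `x ↦ x ^ p` and the kernel `6 * x * (1 - x)`. -/
lemma one_div_six_rpow_le_integral {p : ℝ} (hp : 1 ≤ p) :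
    (1 / 6 : ℝ) ^ p ≤ ∫ x in (0 : ℝ)..1, (x * (1 - x)) ^ p := by
  have hcont : Continuous fun x : ℝ ↦ (x * (1 - x)) ^ p :=
    Continuous.rpow_const (by fun_prop) fun _ ↦ Or.inr (by linarith)
  have hmono : ∫ x in (0 : ℝ)..1, (1 / 6 : ℝ) ^ p * (1 - p + 6 * p * ((x - 0) * (1 - x)))
      ≤ ∫ x in (0 : ℝ)..1, (x * (1 - x)) ^ p := by
    refine intervalIntegral.integral_mono_on zero_le_one
      (Continuous.intervalIntegrable (by fun_prop) _ _) (hcont.intervalIntegrable _ _)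
      fun x hx ↦ ?_
    have h0 : 0 ≤ x * (1 - x) := mul_nonneg hx.1 (sub_nonneg.2 hx.2)
    have hB := one_add_mul_self_le_rpow_one_add (s := 6 * (x * (1 - x)) - 1) (by linarith) hp
    calc _ = (1 / 6 : ℝ) ^ p * (1 + p * (6 * (x * (1 - x)) - 1)) := by ring
      _ ≤ (1 / 6 : ℝ) ^ p * (1 + (6 * (x * (1 - x)) - 1)) ^ p := by gcongr
      _ = _ := by
        rw [← Real.mul_rpow (by norm_num) (by linarith)]
        congr 1
        ring
  rw [intervalIntegral.integral_const_mul, intervalIntegral.integral_add (by simp)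
    (Continuous.intervalIntegrable (by fun_prop) _ _), intervalIntegral.integral_const_mul,
    integral_peano_kernel] at hmono
  convert hmono using 1
  simp
  ring

lemma two_thirds_rpow_le_Gamma_ratio {p : ℝ} (hp : 1 ≤ p) :
    (2 / 3 : ℝ) ^ p ≤
      Real.sqrt Real.pi / 2 * (Real.Gamma (p + 1) / Real.Gamma (3 / 2 + p)) := by
  have hJ := one_div_six_rpow_le_integral hp
  rw [integral_rpow_mul_one_sub_rpow (by linarith)] at hJ
  have hD := Real.Gamma_mul_Gamma_add_half (p + 1)
  rw [show p + 1 + 1 / 2 = 3 / 2 + p by ring] at hD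
  have hG : 0 < Real.Gamma (3 / 2 + p) := Real.Gamma_pos_of_pos (by linarith)
  have hG2 : 0 < Real.Gamma (2 * (p + 1)) := Real.Gamma_pos_of_pos (by linarith)
  have h4 : (4 : ℝ) ^ p * 2 ^ (1 - 2 * (p + 1)) = 1 / 2 := by
    rw [show (4 : ℝ) = 2 ^ (2 : ℝ) by norm_num, ← Real.rpow_mul zero_le_two,
      ← Real.rpow_add two_pos, show 2 * p + (1 - 2 * (p + 1)) = -1 by ring, Real.rpow_neg_one]
    norm_num
  calc (2 / 3 : ℝ) ^ p = 4 ^ p * (1 / 6) ^ p := by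
        rw [← Real.mul_rpow (by norm_num) (by norm_num)]
        norm_num
    _ ≤ 4 ^ p * (Real.Gamma (p + 1) * Real.Gamma (p + 1) / Real.Gamma (2 * (p + 1))) := by
        gcongr
    _ = _ := by
        generalize Real.Gamma (3 / 2 + p) = u at hD hG ⊢
        generalize Real.Gamma (2 * (p + 1)) = v at hD hG2 ⊢
        field_simp
        linear_combination 2 * (4 : ℝ) ^ p * hD + 2 * v * Real.sqrt Real.pi * h4


theorem stmt_6 (a b c p q : ℝ) (f f' f'' : ℝ → ℝ) (A B : ℝ)
    (hab : a < b) (hc0 : 0 < c) (hc1 : c ≤ 1)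
    (hp : 1 < p) (hq : q = p / (p - 1))
    (hA : A < a) (hB : a + c * (b - a) < B)
    (hf' : ∀ x ∈ Set.Ioo A B, HasDerivAt f (f' x) x)
    (hf'' : ∀ x ∈ Set.Ioo A B, HasDerivAt f' (f'' x) x)
    (hint : IntervalIntegrable f'' MeasureTheory.volume a (a + c * (b - a)))
    (hphi : ∀ t ∈ Set.Icc (0:ℝ) 1,
      |f'' (a + t * c * (b - a))| ^ q ≤ max (|f'' a| ^ q) (|f'' b| ^ q)) :
    |(1 / (c * (b - a))) * (∫ x in a..(a + c * (b - a)), f x)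
        - (f a + f (a + c * (b - a))) / 2|
      ≤ (c ^ 2 * (b - a) ^ 2 / 8) * (Real.sqrt Real.pi / 2) ^ (1 / p)
          * (Real.Gamma (p + 1) / Real.Gamma (3 / 2 + p)) ^ (1 / p)
          * (max (|f'' a| ^ q) (|f'' b| ^ q)) ^ (1 / q) := by
  have hp0 : 0 < p := by linarith
  have hq0 : 0 < q := hq ▸ div_pos hp0 (by linarith)
  have hh : 0 < c * (b - a) := mul_pos hc0 (sub_pos.2 hab)
  have hsub : ∀ x ∈ Set.Icc a (a + c * (b - a)), x ∈ Set.Ioo A B := fun x hx ↦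
    ⟨hA.trans_le hx.1, hx.2.trans_lt hB⟩
  set m := max (|f'' a| ^ q) (|f'' b| ^ q)
  have hm : 0 ≤ m := le_max_of_le_left (by positivity)
  have hbound : ∀ x ∈ Set.Icc a (a + c * (b - a)), |f'' x| ≤ m ^ (1 / q) := fun x hx ↦ by
    have ht := hphi ((x - a) / (c * (b - a)))
      ⟨div_nonneg (sub_nonneg.2 hx.1) hh.le, (div_le_one hh).2 (by linarith [hx.2])⟩
    rw [mul_assoc, div_mul_cancel₀ _ hh.ne', add_sub_cancel] at ht
    rwa [one_div, Real.le_rpow_inv_iff_of_pos (abs_nonneg _) hm hq0]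
  have htrap := abs_average_sub_trapezoid_le (lt_add_of_pos_right a hh)
    (fun x hx ↦ hf' x (hsub x hx)) (fun x hx ↦ hf'' x (hsub x hx)) hint hbound
  rw [add_sub_cancel_left] at htrap
  have hY : 0 ≤ Real.Gamma (p + 1) / Real.Gamma (3 / 2 + p) :=
    div_nonneg (Real.Gamma_pos_of_pos (by linarith)).le (Real.Gamma_pos_of_pos (by linarith)).le
  have hΓ : 2 / 3 ≤ (Real.sqrt Real.pi / 2) ^ (1 / p)
      * (Real.Gamma (p + 1) / Real.Gamma (3 / 2 + p)) ^ (1 / p) := by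
    rw [← Real.mul_rpow (by positivity) hY, one_div,
      Real.le_rpow_inv_iff_of_pos (by norm_num) (by positivity) hp0]
    exact two_thirds_rpow_le_Gamma_ratio hp.le
  calc _ ≤ (c * (b - a)) ^ 2 / 12 * m ^ (1 / q) := htrap
    _ = c ^ 2 * (b - a) ^ 2 / 8 * (2 / 3) * m ^ (1 / q) := by ring
    _ ≤ _ := by
      rw [mul_assoc (c ^ 2 * (b - a) ^ 2 / 8) (_ ^ _) (_ ^ _)]
      gcongr
end

section
/- Let a < b be real numbers, let c ∈ (0,1] be a fixed real constant, and let q ≥ 1. Let f be twice differentiable on an open interval containing [a, a + c(b−a)] with f'' integrable on [a, a + c(b−a)]. If |f''|^q is quasi-φ-convex along the path from a to b, i.e. |f''(a + t c(b−a))|^q ≤ max{ |f''(a)|^q, |f''(b)|^q } for all t ∈ [0,1], then | (1/(c(b−a))) ∫_a^{a+c(b−a)} f(x) dx − (f(a) + f(a + c(b−a)))/2 | ≤ (c²(b−a)²/12) ( max{ |f''(a)|^q, |f''(b)|^q } )^{1/q}. -/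
/-- The trapezoidal rule with the integral form of its error term. -/
theorem integral_add_integral_mul_eq_trapezoid {f f' f'' : ℝ → ℝ} {a d : ℝ} (had : a ≤ d)
    (hf' : ∀ x ∈ Set.Icc a d, HasDerivAt f (f' x) x)
    (hf'' : ∀ x ∈ Set.Icc a d, HasDerivAt f' (f'' x) x)
    (hint : IntervalIntegrable f'' MeasureTheory.volume a d) :
    2 * (∫ x in a..d, f x) + ∫ x in a..d, (x - a) * (d - x) * f'' x
      = (d - a) * (f a + f d) := by
  have hf : IntervalIntegrable f MeasureTheory.volume a d := by
    apply ContinuousOn.intervalIntegrable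
    rw [Set.uIcc_of_le had]
    exact fun x hx => (hf' x hx).continuousAt.continuousWithinAt
  have hp : IntervalIntegrable (fun x => (x - a) * (d - x) * f'' x)
      MeasureTheory.volume a d :=
    hint.continuousOn_mul (by fun_prop)
  have key := intervalIntegral.integral_eq_sub_of_hasDerivAt
    (f := fun x => (x - a) * (d - x) * f' x - (a + d - 2 * x) * f x)
    (f' := fun x => 2 * f x + (x - a) * (d - x) * f'' x) (a := a) (b := d)
    (fun x hx => by
      rw [Set.uIcc_of_le had] at hx
      have h1 := (((hasDerivAt_id x).sub_const a).mul ((hasDerivAt_id x).const_sub d)).mul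
        (hf'' x hx)
      have h2 := (((hasDerivAt_id x).const_mul 2).const_sub (a + d)).mul (hf' x hx)
      refine (h1.sub h2).congr_deriv ?_
      simp only [id, Pi.mul_apply]
      ring)
    ((hf.const_mul 2).add hp)
  rw [intervalIntegral.integral_add (hf.const_mul 2) hp,
    intervalIntegral.integral_const_mul] at key
  rw [key]
  ring

theorem integral_sub_mul_sub (a d : ℝ) :
    ∫ x in a..d, (x - a) * (d - x) = (d - a) ^ 3 / 6 := by
  have key := intervalIntegral.integral_eq_sub_of_hasDerivAt
    (f := fun x => (d - a) * (x - a) ^ 2 / 2 - (x - a) ^ 3 / 3)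
    (f' := fun x => (x - a) * (d - x)) (a := a) (b := d)
    (fun x _ => by
      have h := (hasDerivAt_id x).sub_const a
      refine ((((h.pow 2).const_mul (d - a)).div_const 2).sub
        ((h.pow 3).div_const 3)).congr_deriv ?_
      simp only [id]
      push_cast
      ring)
    (Continuous.intervalIntegrable (by fun_prop) _ _)
  rw [key]
  ring

theorem abs_integral_sub_mul_sub_mul_le {g : ℝ → ℝ} {a d M : ℝ} (had : a ≤ d)
    (hg : ∀ x ∈ Set.Icc a d, |g x| ≤ M) :
    |∫ x in a..d, (x - a) * (d - x) * g x| ≤ M * ((d - a) ^ 3 / 6) := by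
  rw [← integral_sub_mul_sub, ← intervalIntegral.integral_const_mul, ← Real.norm_eq_abs]
  refine intervalIntegral.norm_integral_le_of_norm_le had
    (Filter.Eventually.of_forall fun x hx => ?_)
    (Continuous.intervalIntegrable (by fun_prop) _ _)
  have hp : 0 ≤ (x - a) * (d - x) :=
    mul_nonneg (sub_nonneg.2 hx.1.le) (sub_nonneg.2 hx.2)
  rw [Real.norm_eq_abs, abs_mul, abs_of_nonneg hp, mul_comm]
  exact mul_le_mul_of_nonneg_right (hg x ⟨hx.1.le, hx.2⟩) hp

theorem stmt_7 (a b c q : ℝ) (f f' f'' : ℝ → ℝ) (A B : ℝ)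
    (hab : a < b) (hc0 : 0 < c) (hc1 : c ≤ 1) (hq : 1 ≤ q)
    (hA : A < a) (hB : a + c * (b - a) < B)
    (hf' : ∀ x ∈ Set.Ioo A B, HasDerivAt f (f' x) x)
    (hf'' : ∀ x ∈ Set.Ioo A B, HasDerivAt f' (f'' x) x)
    (hint : IntervalIntegrable f'' MeasureTheory.volume a (a + c * (b - a)))
    (hphi : ∀ t ∈ Set.Icc (0:ℝ) 1,
      |f'' (a + t * c * (b - a))| ^ q ≤ max (|f'' a| ^ q) (|f'' b| ^ q)) :
    |(1 / (c * (b - a))) * (∫ x in a..(a + c * (b - a)), f x)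
        - (f a + f (a + c * (b - a))) / 2|
      ≤ (c ^ 2 * (b - a) ^ 2 / 12) * (max (|f'' a| ^ q) (|f'' b| ^ q)) ^ (1 / q) := by
  have hq0 : 0 < q := by linarith
  have hh : 0 < c * (b - a) := mul_pos hc0 (sub_pos.2 hab)
  have hbound : ∀ x ∈ Set.Icc a (a + c * (b - a)),
      |f'' x| ≤ (max (|f'' a| ^ q) (|f'' b| ^ q)) ^ (1 / q) := by
    intro x hx
    have h := hphi ((x - a) / (c * (b - a)))
      ⟨div_nonneg (sub_nonneg.2 hx.1) hh.le, (div_le_one hh).2 (by linarith [hx.2])⟩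
    rw [mul_assoc, div_mul_cancel₀ _ hh.ne', add_sub_cancel] at h
    rw [one_div]
    exact (Real.le_rpow_inv_iff_of_pos (abs_nonneg _)
      (le_max_of_le_left (by positivity)) hq0).2 h
  have hd : a ≤ a + c * (b - a) := by linarith
  have hsub : ∀ x ∈ Set.Icc a (a + c * (b - a)), x ∈ Set.Ioo A B :=
    fun x hx => ⟨hA.trans_le hx.1, hx.2.trans_lt hB⟩
  have hid := integral_add_integral_mul_eq_trapezoid hd (fun x hx => hf' x (hsub x hx))
    (fun x hx => hf'' x (hsub x hx)) hint
  have hle := abs_integral_sub_mul_sub_mul_le hd hbound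
  rw [← mul_pow]
  generalize (max (|f'' a| ^ q) (|f'' b| ^ q)) ^ (1 / q) = M at hle ⊢
  generalize (∫ x in a..(a + c * (b - a)), (x - a) * (a + c * (b - a) - x) * f'' x) = J
    at hid hle
  generalize (∫ x in a..(a + c * (b - a)), f x) = I at hid ⊢
  generalize c * (b - a) = h at *
  rw [add_sub_cancel_left] at hid hle
  have herr : 1 / h * I - (f a + f (a + h)) / 2 = -(J / (2 * h)) := by
    field_simp
    linarith
  rw [herr, abs_neg, abs_div, abs_of_pos (by positivity : 0 < 2 * h),
    div_le_iff₀ (by positivity)]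
  linarith
end

section
/- Let a < b be nonnegative real numbers, let s ∈ [0,1], and let q ≥ 1. Let f be twice differentiable on an open interval containing [a,b] with f'' integrable on [a,b]. If |f''|^q is s-convex on [a,b], i.e. |f''(t x + (1−t) y)|^q ≤ t^s |f''(x)|^q + (1−t)^s |f''(y)|^q for all x, y ∈ [a,b] and t ∈ [0,1], then | (f(a)+f(b))/2 − (1/(b−a)) ∫_a^b f(x) dx | ≤ ((b−a)²/2) · 6^{−(1−1/q)} · ( ( |f''(a)|^q + |f''(b)|^q ) / ((s+2)(s+3)) )^{1/q}. -/
/-- The trapezoid error on `[0, 1]` as an integral of the second derivative. -/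
theorem trapezoid_error_unitInterval {g g' g'' : ℝ → ℝ}
    (hg : ∀ t ∈ Set.Icc (0:ℝ) 1, HasDerivAt g (g' t) t)
    (hg' : ∀ t ∈ Set.Icc (0:ℝ) 1, HasDerivAt g' (g'' t) t)
    (hint : IntervalIntegrable g'' MeasureTheory.volume 0 1) :
    (g 0 + g 1) / 2 - ∫ t in (0:ℝ)..1, g t
      = (1 / 2) * ∫ t in (0:ℝ)..1, t * (1 - t) * g'' t := by
  have hu : Set.uIcc (0:ℝ) 1 = Set.Icc 0 1 := Set.uIcc_of_le zero_le_one
  have hgi : IntervalIntegrable g MeasureTheory.volume 0 1 :=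
    ContinuousOn.intervalIntegrable fun t ht =>
      (hg t (hu ▸ ht)).continuousAt.continuousWithinAt
  have hwi : IntervalIntegrable (fun t => t * (1 - t) * g'' t) MeasureTheory.volume 0 1 :=
    hint.continuousOn_mul (by fun_prop)
  have key : ∫ t in (0:ℝ)..1, (t * (1 - t) * g'' t + 2 * g t) = g 0 + g 1 := by
    rw [intervalIntegral.integral_eq_sub_of_hasDerivAt
      (f := fun t => t * (1 - t) * g' t - (1 - 2 * t) * g t) _ (hwi.add (hgi.const_mul 2))]
    · norm_num
      ring
    · intro t ht
      rw [hu] at ht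
      have h1 : HasDerivAt (fun t : ℝ => t * (1 - t)) (1 - 2 * t) t := by
        refine ((hasDerivAt_id t).mul ((hasDerivAt_id t).const_sub 1)).congr_deriv ?_
        simp only [id]
        ring
      have h2 : HasDerivAt (fun t : ℝ => 1 - 2 * t) (-2) t := by
        simpa using ((hasDerivAt_id t).const_mul 2).const_sub 1
      refine ((h1.mul (hg' t ht)).sub (h2.mul (hg t ht))).congr_deriv ?_
      ring
  rw [intervalIntegral.integral_add hwi (hgi.const_mul 2),
    intervalIntegral.integral_const_mul] at key
  linarith

/-- The tangent line to `u ↦ u ^ q` at `m` lies below the graph. -/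
theorem rpow_tangent_le {m u q : ℝ} (hm : 0 < m) (hu : 0 ≤ u) (hq : 1 ≤ q) :
    m ^ q + q * (m ^ q / m) * (u - m) ≤ u ^ q := by
  have h := one_add_mul_self_le_rpow_one_add (s := u / m - 1)
    (by linarith [div_nonneg hu hm.le]) hq
  rw [add_sub_cancel, Real.div_rpow hu hm.le, le_div_iff₀ (Real.rpow_pos_of_pos hm q)] at h
  calc m ^ q + q * (m ^ q / m) * (u - m) = (1 + q * (u / m - 1)) * m ^ q := by
        field_simp
    _ ≤ u ^ q := h

theorem integral_mul_one_sub : ∫ t in (0:ℝ)..1, t * (1 - t) = 1 / 6 := by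
  have : (fun t : ℝ => t * (1 - t)) = fun t => t ^ 1 - t ^ 2 := by
    funext t
    ring
  rw [this, intervalIntegral.integral_sub (by simp) (by simp), integral_pow, integral_pow]
  norm_num

theorem integral_mul_one_sub_mul_rpow {s : ℝ} (hs : 0 ≤ s) :
    ∫ t in (0:ℝ)..1, t * (1 - t) * t ^ s = 1 / ((s + 2) * (s + 3)) := by
  have h : ∀ t ∈ Set.uIcc (0:ℝ) 1, t * (1 - t) * t ^ s = t ^ (s + 1) - t ^ (s + 2) := by
    intro t ht
    rw [Set.uIcc_of_le zero_le_one] at ht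
    rw [Real.rpow_add_of_nonneg ht.1 hs zero_le_one, Real.rpow_add_of_nonneg ht.1 hs zero_le_two,
      Real.rpow_one, Real.rpow_two]
    ring
  rw [intervalIntegral.integral_congr h, intervalIntegral.integral_sub
    (intervalIntegral.intervalIntegrable_rpow' (by linarith))
    (intervalIntegral.intervalIntegrable_rpow' (by linarith)),
    integral_rpow (Or.inl (by linarith)), integral_rpow (Or.inl (by linarith)),
    Real.one_rpow, Real.one_rpow, Real.zero_rpow (by linarith), Real.zero_rpow (by linarith)]
  field_simp
  ring

theorem integral_mul_one_sub_mul_one_sub_rpow {s : ℝ} (hs : 0 ≤ s) :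
    ∫ t in (0:ℝ)..1, t * (1 - t) * (1 - t) ^ s = 1 / ((s + 2) * (s + 3)) := by
  rw [← integral_mul_one_sub_mul_rpow hs]
  have h := intervalIntegral.integral_comp_sub_left
    (fun t : ℝ => t * (1 - t) * t ^ s) (a := 0) (b := 1) 1
  simp only [sub_self, sub_zero, sub_sub_cancel] at h
  rw [← h]
  exact intervalIntegral.integral_congr fun t _ => by ring

/-- Power mean estimate for the weight `t * (1 - t)`, with an `s`-convex majorant of `u ^ q`. -/
theorem integral_mul_one_sub_mul_le {u : ℝ → ℝ} {s q P Q : ℝ} (hs : 0 ≤ s) (hq : 1 ≤ q)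
    (hP : 0 ≤ P) (hQ : 0 ≤ Q) (hu : ∀ t, 0 ≤ u t)
    (hint : IntervalIntegrable u MeasureTheory.volume 0 1)
    (hbound : ∀ t ∈ Set.Icc (0:ℝ) 1, u t ^ q ≤ t ^ s * P + (1 - t) ^ s * Q) :
    ∫ t in (0:ℝ)..1, t * (1 - t) * u t
      ≤ (6:ℝ) ^ (-(1 - 1 / q)) * ((P + Q) / ((s + 2) * (s + 3))) ^ (1 / q) := by
  set C := (P + Q) / ((s + 2) * (s + 3)) with hC
  set I := ∫ t in (0:ℝ)..1, t * (1 - t) * u t with hI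
  have hC0 : 0 ≤ C := by positivity
  rcases le_or_gt I 0 with hI0 | hI0
  · exact hI0.trans (by positivity)
  have hm : 0 < 6 * I := by linarith
  have hq0 : 0 < q := by linarith
  have hcw : Continuous fun t : ℝ => t * (1 - t) := by fun_prop
  have hwu : IntervalIntegrable (fun t => t * (1 - t) * u t) MeasureTheory.volume 0 1 :=
    hint.continuousOn_mul hcw.continuousOn
  have hw : IntervalIntegrable (fun t : ℝ => t * (1 - t)) MeasureTheory.volume 0 1 :=
    hcw.intervalIntegrable 0 1
  have hrs : Continuous fun t : ℝ => t ^ s := Real.continuous_rpow_const hs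
  have hr1 : IntervalIntegrable (fun t : ℝ => t * (1 - t) * t ^ s)
      MeasureTheory.volume 0 1 := (hcw.mul hrs).intervalIntegrable 0 1
  have hr2 : IntervalIntegrable (fun t : ℝ => t * (1 - t) * (1 - t) ^ s)
      MeasureTheory.volume 0 1 :=
    (hcw.mul (hrs.comp (continuous_const.sub continuous_id))).intervalIntegrable 0 1
  set c := q * ((6 * I) ^ q / (6 * I)) with hc
  have hmono : ∫ t in (0:ℝ)..1, (((6 * I) ^ q - c * (6 * I)) * (t * (1 - t))
        + c * (t * (1 - t) * u t))
      ≤ ∫ t in (0:ℝ)..1, (P * (t * (1 - t) * t ^ s) + Q * (t * (1 - t) * (1 - t) ^ s)) := by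
    refine intervalIntegral.integral_mono_on zero_le_one
      ((hw.const_mul _).add (hwu.const_mul _)) ((hr1.const_mul _).add (hr2.const_mul _)) ?_
    intro t ht
    have h := mul_le_mul_of_nonneg_left ((rpow_tangent_le hm (hu t) hq).trans (hbound t ht))
      (mul_nonneg ht.1 (sub_nonneg.2 ht.2))
    rw [← hc] at h
    linarith
  rw [intervalIntegral.integral_add (hw.const_mul _) (hwu.const_mul _),
    intervalIntegral.integral_add (hr1.const_mul _) (hr2.const_mul _),
    intervalIntegral.integral_const_mul, intervalIntegral.integral_const_mul,
    intervalIntegral.integral_const_mul, intervalIntegral.integral_const_mul,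
    integral_mul_one_sub, integral_mul_one_sub_mul_rpow hs,
    integral_mul_one_sub_mul_one_sub_rpow hs, ← hI] at hmono
  have hpow : (6 * I) ^ q ≤ 6 * C := by
    have : C = P * (1 / ((s + 2) * (s + 3))) + Q * (1 / ((s + 2) * (s + 3))) := by
      rw [hC]
      ring
    linarith
  have hroot : 6 * I ≤ 6 ^ (1 / q) * C ^ (1 / q) := by
    rw [← Real.mul_rpow (by norm_num) hC0, one_div]
    exact (Real.le_rpow_inv_iff_of_pos hm.le (by positivity) hq0).2 hpow
  have h6 : (6:ℝ) ^ (-(1 - 1 / q)) = 6 ^ (1 / q) / 6 := by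
    rw [neg_sub, Real.rpow_sub_one (by norm_num)]
  rw [h6]
  linarith

theorem stmt_11 (a b s q : ℝ) (f f' f'' : ℝ → ℝ) (A B : ℝ)
    (ha0 : 0 ≤ a) (hab : a < b) (hs : s ∈ Set.Icc (0:ℝ) 1) (hq : 1 ≤ q)
    (hA : A < a) (hB : b < B)
    (hf' : ∀ x ∈ Set.Ioo A B, HasDerivAt f (f' x) x)
    (hf'' : ∀ x ∈ Set.Ioo A B, HasDerivAt f' (f'' x) x)
    (hint : IntervalIntegrable f'' MeasureTheory.volume a b)
    (hsconv : ∀ x ∈ Set.Icc a b, ∀ y ∈ Set.Icc a b, ∀ t ∈ Set.Icc (0:ℝ) 1,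
      |f'' (t * x + (1 - t) * y)| ^ q ≤ t ^ s * |f'' x| ^ q + (1 - t) ^ s * |f'' y| ^ q) :
    |(f a + f b) / 2 - (1 / (b - a)) * ∫ x in a..b, f x|
      ≤ ((b - a) ^ 2 / 2) * (6:ℝ) ^ (-(1 - 1 / q))
          * ((|f'' a| ^ q + |f'' b| ^ q) / ((s + 2) * (s + 3))) ^ (1 / q) := by
  have hba : 0 < b - a := sub_pos.2 hab
  have hφ : ∀ t : ℝ, HasDerivAt (fun t => t * a + (1 - t) * b) (a - b) t := by
    intro t
    refine (((hasDerivAt_id t).mul_const a).add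
      (((hasDerivAt_id t).const_sub 1).mul_const b)).congr_deriv ?_
    ring
  have hφm : ∀ t ∈ Set.Icc (0:ℝ) 1, t * a + (1 - t) * b ∈ Set.Ioo A B := by
    intro t ht
    have h1 := mul_nonneg ht.1 hba.le
    have h2 := mul_nonneg (sub_nonneg.2 ht.2) hba.le
    constructor <;> nlinarith
  have hφe : ∀ t : ℝ, t * a + (1 - t) * b = (a - b) * t + b := fun t => by ring
  have hφi : IntervalIntegrable (fun t => f'' (t * a + (1 - t) * b))
      MeasureTheory.volume 0 1 := by
    simp only [hφe]
    have h := (hint.symm.comp_add_right b).comp_mul_left (c := a - b)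
    have hne : a - b ≠ 0 := by linarith
    simpa [hne] using h
  have htrap := trapezoid_error_unitInterval
    (g := fun t => f (t * a + (1 - t) * b))
    (g' := fun t => f' (t * a + (1 - t) * b) * (a - b))
    (g'' := fun t => f'' (t * a + (1 - t) * b) * (a - b) * (a - b))
    (fun t ht => (hf' _ (hφm t ht)).comp t (hφ t))
    (fun t ht => ((hf'' _ (hφm t ht)).comp t (hφ t)).mul_const _)
    ((hφi.mul_const _).mul_const _)
  have hsub : ∫ t in (0:ℝ)..1, f (t * a + (1 - t) * b) = (1 / (b - a)) * ∫ x in a..b, f x := by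
    simp only [hφe]
    rw [intervalIntegral.integral_comp_mul_add f (by linarith : a - b ≠ 0) b,
      intervalIntegral.integral_symm]
    simp only [mul_zero, zero_add, mul_one, sub_add_cancel, smul_eq_mul]
    rw [intervalIntegral.integral_symm, ← neg_sub b a, inv_neg, one_div]
    simp
  have hpull : ∫ t in (0:ℝ)..1, t * (1 - t) * (f'' (t * a + (1 - t) * b) * (a - b) * (a - b))
      = (b - a) ^ 2 * ∫ t in (0:ℝ)..1, t * (1 - t) * f'' (t * a + (1 - t) * b) := by
    rw [← intervalIntegral.integral_const_mul]
    exact intervalIntegral.integral_congr fun t _ => by ring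
  have habs : |∫ t in (0:ℝ)..1, t * (1 - t) * f'' (t * a + (1 - t) * b)|
      ≤ ∫ t in (0:ℝ)..1, t * (1 - t) * |f'' (t * a + (1 - t) * b)| := by
    refine (intervalIntegral.abs_integral_le_integral_abs zero_le_one).trans_eq
      (intervalIntegral.integral_congr fun t ht => ?_)
    rw [Set.uIcc_of_le zero_le_one] at ht
    simp only [abs_mul, abs_of_nonneg ht.1, abs_of_nonneg (sub_nonneg.2 ht.2)]
  have hmain := integral_mul_one_sub_mul_le (u := fun t => |f'' (t * a + (1 - t) * b)|)
    hs.1 hq (Real.rpow_nonneg (abs_nonneg (f'' a)) q) (Real.rpow_nonneg (abs_nonneg (f'' b)) q)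
    (fun t => abs_nonneg _) hφi.abs
    (fun t ht => hsconv a (Set.left_mem_Icc.2 hab.le) b (Set.right_mem_Icc.2 hab.le) t ht)
  have hfab : (f a + f b) / 2 - (1 / (b - a)) * ∫ x in a..b, f x
      = (b - a) ^ 2 / 2 * ∫ t in (0:ℝ)..1, t * (1 - t) * f'' (t * a + (1 - t) * b) := by
    rw [hsub, hpull] at htrap
    simp only [zero_mul, sub_zero, one_mul, zero_add, sub_self, add_zero] at htrap
    linarith
  rw [hfab, abs_mul, abs_of_nonneg (by positivity), mul_assoc]
  exact mul_le_mul_of_nonneg_left (habs.trans hmain) (by positivity)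
end

section
/- Let a < b be real numbers and let c ∈ (0,1] be a fixed real constant. Let f : [a,b] → (0,∞) be continuous and φ-convex on [a,b] with respect to c, i.e. f(u + t c(v−u)) ≤ (1−t) f(u) + t f(v) for all u, v ∈ [a,b] and t ∈ [0,1]. Then the following chain of inequalities holds: f( (2a + c(b−a))/2 ) ≤ (1/(c(b−a))) ∫_a^{a+c(b−a)} f(x) dx ≤ ( f(a) + f(a + c(b−a)) )/2 ≤ ( f(a) + f(b) )/2. -/
/-- The Hermite–Hadamard inequalities, in multiplied-out form, for a continuous convex function. -/
theorem ConvexOn.hermite_hadamard {p q : ℝ} {f : ℝ → ℝ} (hpq : p ≤ q)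
    (hf : ConvexOn ℝ (Set.Icc p q) f) (hcont : ContinuousOn f (Set.Icc p q)) :
    (q - p) * f ((p + q) / 2) ≤ ∫ x in p..q, f x ∧
      ∫ x in p..q, f x ≤ (q - p) * ((f p + f q) / 2) := by
  have hint : IntervalIntegrable f MeasureTheory.volume p q :=
    hcont.intervalIntegrable_of_Icc hpq
  have hrefl : ContinuousOn (fun x ↦ f (p + q - x)) (Set.Icc p q) :=
    hcont.comp (by fun_prop) fun x hx ↦ ⟨by linarith [hx.2], by linarith [hx.1]⟩
  have hint' : IntervalIntegrable (fun x ↦ f (p + q - x)) MeasureTheory.volume p q :=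
    hrefl.intervalIntegrable_of_Icc hpq
  have hsum : ∫ x in p..q, (f x + f (p + q - x)) = 2 * ∫ x in p..q, f x := by
    rw [intervalIntegral.integral_add hint hint', intervalIntegral.integral_comp_sub_left]
    simp [two_mul]
  have hlower : ∀ x ∈ Set.Icc p q, 2 * f ((p + q) / 2) ≤ f x + f (p + q - x) := by
    intro x hx
    have hx' : p + q - x ∈ Set.Icc p q := ⟨by linarith [hx.2], by linarith [hx.1]⟩
    have h := hf.2 hx hx' (by norm_num : (0 : ℝ) ≤ 1 / 2) (by norm_num : (0 : ℝ) ≤ 1 / 2)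
      (by norm_num)
    simp only [smul_eq_mul] at h
    rw [show 1 / 2 * x + 1 / 2 * (p + q - x) = (p + q) / 2 by ring] at h
    linarith
  have hupper : ∀ x ∈ Set.Icc p q, f x + f (p + q - x) ≤ f p + f q := by
    intro x hx
    rw [← segment_eq_Icc hpq] at hx
    obtain ⟨s, t, hs, ht, hst, rfl⟩ := hx
    have hp := Set.left_mem_Icc.2 hpq
    have hq := Set.right_mem_Icc.2 hpq
    have h₁ := hf.2 hp hq hs ht hst
    have h₂ := hf.2 hp hq ht hs (by linarith)
    obtain rfl : t = 1 - s := by linarith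
    simp only [smul_eq_mul] at h₁ h₂ ⊢
    rw [show p + q - (s * p + (1 - s) * q) = (1 - s) * p + s * q by ring]
    linarith
  have hl := intervalIntegral.integral_mono_on hpq intervalIntegrable_const (hint.add hint') hlower
  have hu := intervalIntegral.integral_mono_on hpq (hint.add hint') intervalIntegrable_const hupper
  rw [hsum, intervalIntegral.integral_const, smul_eq_mul] at hl hu
  constructor <;> linarith

/-- A continuous function with `f (u + c * (v - u)) ≤ f v` for some `c ∈ (0, 1)` is constant. -/
theorem eq_of_forall_apply_contraction_le {a b c : ℝ} {f : ℝ → ℝ} (hc0 : 0 < c) (hc1 : c < 1)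
    (hcont : ContinuousOn f (Set.Icc a b))
    (h : ∀ u ∈ Set.Icc a b, ∀ v ∈ Set.Icc a b, f (u + c * (v - u)) ≤ f v) :
    ∀ u ∈ Set.Icc a b, ∀ v ∈ Set.Icc a b, f u = f v := by
  suffices key : ∀ u ∈ Set.Icc a b, ∀ v ∈ Set.Icc a b, f u ≤ f v from
    fun u hu v hv ↦ le_antisymm (key u hu v hv) (key v hv u hu)
  intro u hu v hv
  have hmem : ∀ n : ℕ, u + c ^ n * (v - u) ∈ Set.Icc a b := fun n ↦
    (convex_Icc a b).add_smul_sub_mem hu hv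
      ⟨pow_nonneg hc0.le n, pow_le_one₀ hc0.le hc1.le⟩
  have hle : ∀ n : ℕ, f (u + c ^ n * (v - u)) ≤ f v := by
    intro n
    induction n with
    | zero => simp
    | succ n ih =>
      refine le_trans (le_of_eq_of_le ?_ (h u hu _ (hmem n))) ih
      congr 1
      ring
  have hlim : Filter.Tendsto (fun n : ℕ ↦ u + c ^ n * (v - u)) Filter.atTop (nhds u) := by
    simpa using
      ((tendsto_pow_atTop_nhds_zero_of_lt_one hc0.le hc1).mul_const (v - u)).const_add u
  exact le_of_tendsto'
    ((hcont u hu).tendsto.comp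
      (tendsto_nhdsWithin_iff.2 ⟨hlim, Filter.Eventually.of_forall hmem⟩)) hle

theorem stmt_15 (a b c : ℝ) (f : ℝ → ℝ)
    (hab : a < b) (hc0 : 0 < c) (hc1 : c ≤ 1)
    (hcont : ContinuousOn f (Set.Icc a b))
    (hpos : ∀ x ∈ Set.Icc a b, 0 < f x)
    (hphi : ∀ u ∈ Set.Icc a b, ∀ v ∈ Set.Icc a b, ∀ t ∈ Set.Icc (0:ℝ) 1,
      f (u + t * c * (v - u)) ≤ (1 - t) * f u + t * f v) :
    f ((2 * a + c * (b - a)) / 2)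
        ≤ (1 / (c * (b - a))) * ∫ x in a..(a + c * (b - a)), f x
      ∧ (1 / (c * (b - a))) * (∫ x in a..(a + c * (b - a)), f x)
          ≤ (f a + f (a + c * (b - a))) / 2
      ∧ (f a + f (a + c * (b - a))) / 2 ≤ (f a + f b) / 2 := by
  have hstep : ∀ u ∈ Set.Icc a b, ∀ v ∈ Set.Icc a b, f (u + c * (v - u)) ≤ f v := by
    intro u hu v hv
    simpa using hphi u hu v hv 1 (by simp)
  have hconv : ConvexOn ℝ (Set.Icc a b) f := by
    refine ⟨convex_Icc a b, fun x hx y hy s t hs ht hst ↦ ?_⟩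
    obtain rfl : s = 1 - t := by linarith
    rcases hc1.eq_or_lt with rfl | hc1
    · have h := hphi x hx y hy t ⟨ht, by linarith⟩
      simp only [smul_eq_mul]
      rwa [show (1 - t) * x + t * y = x + t * 1 * (y - x) by ring]
    · have hconst := eq_of_forall_apply_contraction_le hc0 hc1 hcont hstep
      rw [hconst _ (convex_Icc a b hx hy hs ht hst) x hx, hconst y hy x hx]
      simp only [smul_eq_mul]
      exact le_of_eq (by ring)
  have hd : 0 < c * (b - a) := mul_pos hc0 (sub_pos.2 hab)
  have hsub : Set.Icc a (a + c * (b - a)) ⊆ Set.Icc a b :=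
    Set.Icc_subset_Icc_right (by nlinarith)
  obtain ⟨hl, hu⟩ := (hconv.subset hsub (convex_Icc _ _)).hermite_hadamard
    (by linarith) (hcont.mono hsub)
  rw [add_sub_cancel_left] at hl hu
  rw [← add_assoc, ← two_mul] at hl
  rw [one_div_mul_eq_div, le_div_iff₀' hd, div_le_iff₀' hd]
  refine ⟨hl, hu, ?_⟩
  linarith [hstep a (Set.left_mem_Icc.2 hab.le) b (Set.right_mem_Icc.2 hab.le)]
end
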